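/- (ε-stable allocations are (2ε+1)-approximately optimal.) Let G be a finite connected simple graph on a vertex set V of n players, let O be a finite set of resources with |O| ≥ 2, and let ε > 1 be real. If P̄ is an ε-stable allocation, then for every allocation Q : V → O, C(P̄) ≤ (2ε+1)·C(Q). -/

import Mathlib

open Finset

noncomputable section

variable {V O : Type*} [Fintype V] [DecidableEq V] [Fintype O] [DecidableEq O]

/-- Diameter of the graph: maximum graph distance between any two vertices. -/
def csrDiam (G : SimpleGraph V) : ℕ :=
  Finset.sup Finset.univ fun i => Finset.sup Finset.univ fun j => G.dist i j

/-- Distance from player `i` to the nearest holder of resource `o` under allocation `P`;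
`csrDiam G + 1` if no one holds `o`. -/
def csrDist (G : SimpleGraph V) (P : V → O) (i : V) (o : O) : ℕ :=
  if h : (Finset.univ.filter fun j => P j = o).Nonempty then
    (Finset.univ.filter fun j => P j = o).inf' h fun j => G.dist i j
  else csrDiam G + 1

/-- Cost of player `i` under allocation `P`. -/
def csrCost (G : SimpleGraph V) (P : V → O) (i : V) : ℕ :=
  ∑ o ∈ Finset.univ.filter (fun o => o ≠ P i), csrDist G P i o

/-- Total cost of allocation `P`. -/
def csrTotal (G : SimpleGraph V) (P : V → O) : ℕ := ∑ i, csrCost G P i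

/-- Radius of player `i`: distance to nearest *other* player holding the same resource;
`csrDiam G` if there is none. -/
def csrRadius (G : SimpleGraph V) (P : V → O) (i : V) : ℕ :=
  if h : (Finset.univ.filter fun j => j ≠ i ∧ P j = P i).Nonempty then
    (Finset.univ.filter fun j => j ≠ i ∧ P j = P i).inf' h fun j => G.dist i j
  else csrDiam G

/-- Ball of radius `r` (a natural number) around `i`. -/
def csrBall (G : SimpleGraph V) (i : V) (r : ℕ) : Finset V :=
  Finset.univ.filter fun j => G.dist i j ≤ r

/-- Pure Nash equilibrium of the CSR game. -/
def csrIsNE (G : SimpleGraph V) (P : V → O) : Prop :=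
  ∀ (i : V) (o : O), csrCost G P i ≤ csrCost G (Function.update P i o) i

/-- An allocation is `ε`-stable if for every player `i` and every resource `o`, some
player holding `o` lies within distance strictly less than `ε · r_i(P)` of `i`. -/
def csrEpsStable (G : SimpleGraph V) (ε : ℝ) (P : V → O) : Prop :=
  ∀ (i : V) (o : O), ∃ j : V, P j = o ∧ (G.dist i j : ℝ) < ε * (csrRadius G P i : ℝ)

theorem csr_dist_le_diam (G : SimpleGraph V) (i j : V) : G.dist i j ≤ csrDiam G := by
  unfold csrDiam
  exact (Finset.le_sup (f := fun j => G.dist i j) (Finset.mem_univ j)).trans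
    (Finset.le_sup (f := fun i => Finset.sup Finset.univ fun j => G.dist i j) (Finset.mem_univ i))

theorem csr_dist_le (G : SimpleGraph V) (P : V → O) (i j : V) :
    csrDist G P i (P j) ≤ G.dist i j := by
  unfold csrDist
  have hj : j ∈ Finset.univ.filter fun k => P k = P j := by simp
  rw [dif_pos ⟨j, hj⟩]
  exact Finset.inf'_le (fun j => G.dist i j) hj

theorem csr_exists (G : SimpleGraph V) (P : V → O) (i : V) (o : O) (h : ∃ j, P j = o) :
    ∃ j, P j = o ∧ G.dist i j = csrDist G P i o := by
  unfold csrDist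
  have hj : (Finset.univ.filter fun k => P k = o).Nonempty := by
    obtain ⟨j, hj⟩ := h
    exact ⟨j, by simpa using hj⟩
  rw [dif_pos hj]
  obtain ⟨j, hj1, hj2⟩ := Finset.exists_mem_eq_inf' hj (fun j => G.dist i j)
  exact ⟨j, by simpa using hj1, hj2.symm⟩

theorem csr_radius_le (G : SimpleGraph V) (P : V → O) (x y : V) (hne : y ≠ x) (h : P y = P x) :
    csrRadius G P x ≤ G.dist x y := by
  unfold csrRadius
  have hj : y ∈ Finset.univ.filter fun j => j ≠ x ∧ P j = P x := by simp [hne, h]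
  rw [dif_pos ⟨y, hj⟩]
  exact Finset.inf'_le (fun j => G.dist x j) hj

theorem csr_cost_eq (G : SimpleGraph V) (P : V → O) (i : V) :
    csrCost G P i = ∑ o, csrDist G P i o := by
  unfold csrCost
  apply Finset.sum_subset (Finset.filter_subset _ _)
  intro o _ ho
  have ho : o = P i := by simpa using ho
  have := csr_dist_le G P i i
  rw [SimpleGraph.dist_self] at this
  rw [ho]
  omega

theorem csr_inj (G : SimpleGraph V) (Q : V → O) (i : V)
    (hc : Fintype.card O ≤ Fintype.card V) :
    ∃ w : O → V, Function.Injective w ∧ ∀ o, G.dist i (w o) ≤ csrDist G Q i o := by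
  classical
  have h1 : ∀ o, ∃ j, (∃ j, Q j = o) → Q j = o ∧ G.dist i j = csrDist G Q i o := by
    intro o
    by_cases h : ∃ j, Q j = o
    · obtain ⟨j, hj⟩ := csr_exists G Q i o h
      exact ⟨j, fun _ => hj⟩
    · exact ⟨i, fun h' => absurd h' h⟩
  choose f hf using h1
  have hinj : Set.InjOn f (Finset.univ.filter fun o => ∃ j, Q j = o : Finset O) := by
    intro a ha b hb hab
    have ha := hf a (by simpa using ha)
    have hb := hf b (by simpa using hb)
    rw [← ha.1, ← hb.1, hab]
  obtain ⟨t, ht1, ht2⟩ := Finset.exists_superset_card_eq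
    (s := (Finset.univ.filter fun o => ∃ j, Q j = o).image f)
    (n := Fintype.card O) (Finset.card_image_le.trans (Finset.card_le_univ _)) hc
  obtain ⟨g, hg⟩ := Finset.exists_equiv_extend_of_card_eq ht2.symm ht1 hinj
  refine ⟨fun o => g o, fun a b hab => g.injective (Subtype.ext hab), fun o => ?_⟩
  by_cases h : ∃ j, Q j = o
  · simp only [hg o (by simpa using h)]
    exact (hf o h).2.le
  · refine (csr_dist_le_diam G _ _).trans ?_
    unfold csrDist
    rw [dif_neg]
    · omega
    · rintro ⟨j, hj⟩
      exact h ⟨j, by simpa using hj⟩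

theorem csr_main (G : SimpleGraph V) (hconn : G.Connected)
    (ε : ℝ) (hε : 1 < ε) (P : V → O) (hst : csrEpsStable G ε P) (i : V)
    (w : O → V) (hw : Function.Injective w) :
    (∑ o, (csrDist G P i o : ℝ)) ≤ (2 * ε + 1) * ∑ o, (G.dist i (w o) : ℝ) := by
  classical
  have h1 : ∀ c, ∃ a, (∃ a, P (w a) = c) →
      P (w a) = c ∧ ∀ b, P (w b) = c → G.dist i (w a) ≤ G.dist i (w b) := by
    intro c
    by_cases h : ∃ a, P (w a) = c
    · obtain ⟨a, ha⟩ := h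
      obtain ⟨m, hm1, hm2⟩ := Finset.exists_min_image
        (Finset.univ.filter fun a => P (w a) = c) (fun a => G.dist i (w a))
        ⟨a, by simpa using ha⟩
      exact ⟨m, fun _ => ⟨by simpa using hm1, fun b hb => hm2 b (by simpa using hb)⟩⟩
    · exact ⟨c, fun h' => absurd h' h⟩
  choose u hu using h1
  have hinj : Set.InjOn u (Finset.univ.filter fun c => ∃ a, P (w a) = c : Finset O) := by
    intro a ha b hb hab
    have ha := hu a (by simpa using ha)
    have hb := hu b (by simpa using hb)
    rw [← ha.1, ← hb.1, hab]
  obtain ⟨g, hg⟩ := Finset.exists_equiv_extend_of_card_eq (t := (Finset.univ : Finset O))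
    (Finset.card_univ).symm (Finset.subset_univ _) hinj
  have hgi : Function.Injective (fun c => (g c : O)) := fun a b hab => g.injective (Subtype.ext hab)
  have hgb : Function.Bijective (fun c => (g c : O)) := Finite.injective_iff_bijective.mp hgi
  rw [← hgb.sum_comp (fun o => (G.dist i (w o) : ℝ)), Finset.mul_sum]
  apply Finset.sum_le_sum
  intro c _
  by_cases h : ∃ a, P (w a) = c
  · have hc := hu c h
    have hgc : (g c : O) = u c := hg c (by simpa using h)
    rw [hgc]
    have h2 := csr_dist_le G P i (w (u c))
    rw [hc.1] at h2
    have h3 : (csrDist G P i c : ℝ) ≤ (G.dist i (w (u c)) : ℝ) := by exact_mod_cast h2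
    have h4 : (0 : ℝ) ≤ (G.dist i (w (u c)) : ℝ) := Nat.cast_nonneg _
    nlinarith
  · have hu' := hu (P (w (g c))) ⟨_, rfl⟩
    have hgc' : (g (P (w (g c))) : O) = u (P (w (g c))) := hg _ (by simp)
    have hne : w (u (P (w (g c)))) ≠ w (g c) := by
      intro he
      have he2 := hw he
      rw [← hgc'] at he2
      have he3 := hgi he2
      exact h ⟨_, he3⟩
    have hr := csr_radius_le G P _ _ hne hu'.1
    have hle := hu'.2 _ rfl
    have htri := hconn.dist_triangle (u := w (g c)) (v := i) (w := w (u (P (w (g c)))))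
    rw [SimpleGraph.dist_comm (u := w (g c)) (v := i)] at htri
    obtain ⟨j, hj, hjd⟩ := hst (w (g c)) c
    have h2 := csr_dist_le G P i j
    rw [hj] at h2
    have htri2 := hconn.dist_triangle (u := i) (v := w (g c)) (w := j)
    have h3 : (csrRadius G P (w (g c)) : ℝ) ≤ 2 * (G.dist i (w (g c)) : ℝ) := by
      have : csrRadius G P (w (g c)) ≤ 2 * G.dist i (w (g c)) := by omega
      exact_mod_cast this
    have h4 : (csrDist G P i c : ℝ) ≤ (G.dist i (w (g c)) : ℝ) + (G.dist (w (g c)) j : ℝ) := by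
      exact_mod_cast h2.trans htri2
    nlinarith

/-- Any `ε`-stable allocation is `(2ε + 1)`-approximately optimal:
`C(P̄) ≤ (2ε + 1) C(Q)` for every allocation `Q`. -/
theorem stmt15 (G : SimpleGraph V) (hconn : G.Connected)
    (hO2 : 2 ≤ Fintype.card O)
    (ε : ℝ) (hε : 1 < ε) (Pbar : V → O) (hstable : csrEpsStable G ε Pbar) :
    ∀ Q : V → O, (csrTotal G Pbar : ℝ) ≤ (2 * ε + 1) * (csrTotal G Q : ℝ) := by
  intro Q
  have hc : Fintype.card O ≤ Fintype.card V :=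
    Fintype.card_le_of_surjective Pbar (fun o => by
      obtain ⟨i⟩ := hconn.nonempty
      obtain ⟨j, hj, _⟩ := hstable i o
      exact ⟨j, hj⟩)
  unfold csrTotal
  push_cast
  rw [Finset.mul_sum]
  apply Finset.sum_le_sum
  intro i _
  rw [csr_cost_eq, csr_cost_eq]
  push_cast
  obtain ⟨w, hw, hwd⟩ := csr_inj G Q i hc
  refine (csr_main G hconn ε hε Pbar hstable i w hw).trans ?_
  apply mul_le_mul_of_nonneg_left _ (by linarith)
  apply Finset.sum_le_sum
  intro o _
  exact_mod_cast hwd o
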